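/- arXiv:2202.11554 — 2 statements merged into one kernel-verified Lean document; each statement's English description precedes it below -/
import Mathlib

section
/- Every edge-symmetric n-person terminal game Γ=(G,v₀,𝓛) has a Nash equilibrium in pure stationary strategies. -/
open scoped Classical

section CoreDefs

variable {V : Type}

/-- A position is terminal iff it has no outgoing edges. -/
def Terminal (E : V → V → Prop) (v : V) : Prop := ∀ u, ¬ E v u

/-- A situation (profile of pure stationary strategies), encoded as a single
successor map: at every non-terminal position it must follow an edge. -/
def IsSituation (E : V → V → Prop) (s : V → V) : Prop :=
  ∀ v, ¬ Terminal E v → E v (s v)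

/-- `s'` is a unilateral deviation of player `i` from `s`: they agree at every
position not controlled by `i` (terminals are controlled by nobody). -/
def Deviation {n : ℕ} (E : V → V → Prop) (owner : V → Fin n) (i : Fin n)
    (s s' : V → V) : Prop :=
  ∀ v, (owner v ≠ i ∨ Terminal E v) → s' v = s v

/-- The play of `s` started at `v` reaches a terminal position. -/
def Reaches (E : V → V → Prop) (s : V → V) (v : V) : Prop :=
  ∃ k, Terminal E (s^[k] v)

/-- First time the play of `s` from `v` is at a terminal position. -/
noncomputable def stopTime (E : V → V → Prop) (s : V → V) (v : V) : ℕ :=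
  sInf {k | Terminal E (s^[k] v)}

/-- The terminal position reached by the play of `s` from `v` (junk if none). -/
noncomputable def playEnd (E : V → V → Prop) (s : V → V) (v : V) : V :=
  s^[stopTime E s v] v

/-- Effective cost in a terminal game: the cost of the terminal reached,
`0` for an infinite play. -/
noncomputable def tCost (E : V → V → Prop) (L : V → ℝ) (s : V → V) (v : V) : ℝ :=
  if Reaches E s v then L (playEnd E s v) else 0

/-- Effective cost in a positive shortest path game: the total length of the
play if it terminates, `+∞` for an infinite play. -/
noncomputable def spCost (E : V → V → Prop) (l : V → V → ℝ) (s : V → V) (v : V) : EReal :=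
  if Reaches E s v then
    (((Finset.range (stopTime E s v)).sum fun k => l (s^[k] v) (s^[k+1] v) : ℝ) : EReal)
  else ⊤

/-- Edge-symmetry: every move can be reversed, except moves entering terminals. -/
def EdgeSymm (E : V → V → Prop) : Prop :=
  ∀ u v, E u v → ¬ Terminal E v → E v u

end CoreDefs

section Helpers

variable {V : Type} {n : ℕ} {E : V → V → Prop} {owner : V → Fin n} {L : Fin n → V → ℝ}

lemma tCost_of_terminal {v : V} (f : V → ℝ) (s : V → V) (hv : Terminal E v) :
    tCost E f s v = f v := by
  have h0 : stopTime E s v = 0 := Nat.sInf_eq_zero.2 (Or.inl hv)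
  rw [tCost, if_pos ⟨0, hv⟩, playEnd, h0]
  rfl

lemma tCost_step {v : V} (f : V → ℝ) (s : V → V) (hv : ¬ Terminal E v) :
    tCost E f s v = tCost E f s (s v) := by
  by_cases hr : Reaches E s (s v)
  · have hr' : Reaches E s v := hr.imp' (· + 1) fun k hk => hk
    have hst : stopTime E s v = stopTime E s (s v) + 1 := by
      refine le_antisymm (Nat.sInf_le (Nat.sInf_mem hr)) ?_
      have hm : Terminal E (s^[stopTime E s v] v) := Nat.sInf_mem hr'
      rcases hk : stopTime E s v with _ | k
      · rw [hk] at hm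
        exact absurd hm hv
      · rw [hk] at hm
        exact Nat.succ_le_succ (Nat.sInf_le hm)
    rw [tCost, tCost, if_pos hr, if_pos hr', playEnd, playEnd, hst]
    rfl
  · have hr' : ¬ Reaches E s v := by
      rintro ⟨_ | k, hk⟩
      · exact hv hk
      · exact hr ⟨k, hk⟩
    rw [tCost, tCost, if_neg hr, if_neg hr']

lemma le_tCost_of_closed {s : V → V} {f : V → ℝ} {c : ℝ} (hc : c ≤ 0) (S : V → Prop)
    (hS : ∀ v, S v → ¬ Terminal E v → S (s v)) (hT : ∀ v, S v → Terminal E v → c ≤ f v)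
    {v : V} (hv : S v) : c ≤ tCost E f s v := by
  by_cases hr : Reaches E s v
  · obtain ⟨k, hk⟩ := hr
    induction k generalizing v with
    | zero => exact (hT v hv hk).trans_eq (tCost_of_terminal f s hk).symm
    | succ k ih =>
      by_cases ht : Terminal E v
      · rw [tCost_of_terminal f s ht]; exact hT v hv ht
      · rw [tCost_step f s ht]
        exact ih (hS v hv ht) hk
  · rwa [tCost, if_neg hr]

lemma tCost_eq_zero_of_closed {s : V → V} {f : V → ℝ} (S : V → Prop)
    (hS : ∀ v, S v → ¬ Terminal E v ∧ S (s v)) {v : V} (hv : S v) : tCost E f s v = 0 := by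
  have hk : ∀ k, S (s^[k] v) := by
    intro k
    induction k with
    | zero => exact hv
    | succ k ih => rw [Function.iterate_succ_apply']; exact (hS _ ih).2
  exact if_neg fun ⟨k, h⟩ => (hS _ (hk k)).1 h

/-- A deviation of `i` does not change the cost of a play on which `i` never moves. -/
lemma tCost_congr_of_closed {s s' : V → V} {i : Fin n} (f : V → ℝ)
    (hd : Deviation E owner i s s') (S : V → Prop)
    (hS : ∀ v, S v → ¬ Terminal E v → owner v ≠ i ∧ S (s v)) {v : V} (hv : S v) :
    tCost E f s' v = tCost E f s v := by
  by_cases hr : Reaches E s v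
  · obtain ⟨k, hk⟩ := hr
    induction k generalizing v with
    | zero => exact (tCost_of_terminal f s' hk).trans (tCost_of_terminal f s hk).symm
    | succ k ih =>
      by_cases ht : Terminal E v
      · rw [tCost_of_terminal f s ht, tCost_of_terminal f s' ht]
      · rw [tCost_step f s ht, tCost_step f s' ht, hd v (Or.inl (hS v hv ht).1)]
        exact ih (hS v hv ht).2 hk
  · rw [tCost_eq_zero_of_closed (fun v => S v ∧ ¬ Reaches E s v) ?_ ⟨hv, hr⟩, tCost, if_neg hr]
    rintro v ⟨hv, hr⟩
    have ht : ¬ Terminal E v := fun h => hr ⟨0, h⟩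
    rw [hd v (Or.inl (hS v hv ht).1)]
    exact ⟨ht, (hS v hv ht).2, fun h => hr (h.imp' (· + 1) fun k hk => hk)⟩

lemma le_tCost_of_deviation {s s' : V → V} {i : Fin n} {f : V → ℝ} {c : ℝ}
    (hs' : IsSituation E s') (hd : Deviation E owner i s s') (hc : c ≤ 0) (S : V → Prop)
    (hown : ∀ v x, S v → owner v = i → E v x → S x)
    (hother : ∀ v, S v → ¬ Terminal E v → owner v ≠ i → S (s v))
    (hT : ∀ v, S v → Terminal E v → c ≤ f v) {v : V} (hv : S v) : c ≤ tCost E f s' v := by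
  refine le_tCost_of_closed hc S (fun v hv ht => ?_) hT hv
  by_cases ho : owner v = i
  · exact hown v _ hv ho (hs' v ht)
  · rw [hd v (Or.inl ho)]
    exact hother v hv ht ho

/-- Successors decreasing the distance to a set along a relation. -/
lemma exists_route (R : V → V → Prop) (P : V → Prop) :
    ∃ (r : V → V) (ρ : V → ℕ), ∀ v, (∃ w, Relation.ReflTransGen R v w ∧ P w) → ¬ P v →
      R v (r v) ∧ ρ (r v) < ρ v := by
  let Q : ℕ → V → Prop := fun k => Nat.rec P (fun _ q v => ∃ w, R v w ∧ q w) k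
  have hQ : ∀ v w, Relation.ReflTransGen R v w → P w → ∃ k, Q k v := by
    intro v w h hw
    induction h using Relation.ReflTransGen.head_induction_on with
    | refl => exact ⟨0, hw⟩
    | head h _ ih =>
      obtain ⟨k, hk⟩ := ih
      exact ⟨k + 1, _, h, hk⟩
  have key : ∀ v, ∃ x, (∃ w, Relation.ReflTransGen R v w ∧ P w) → ¬ P v →
      R v x ∧ sInf {k | Q k x} < sInf {k | Q k v} := by
    intro v
    by_cases h : (∃ w, Relation.ReflTransGen R v w ∧ P w) ∧ ¬ P v
    · obtain ⟨⟨w, hvw, hw⟩, hP⟩ := h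
      have hm : Q (sInf {k | Q k v}) v := Nat.sInf_mem (hQ v w hvw hw)
      rcases hk : sInf {k | Q k v} with _ | k
      · rw [hk] at hm
        exact absurd hm hP
      · rw [hk] at hm
        obtain ⟨x, hx, hxk⟩ := hm
        exact ⟨x, fun _ _ => ⟨hx, Nat.lt_succ_of_le (Nat.sInf_le hxk)⟩⟩
    · exact ⟨v, fun h1 h2 => absurd ⟨h1, h2⟩ h⟩
  choose r hr using key
  exact ⟨r, fun v => sInf {k | Q k v}, hr⟩

/-- A move between two positions of the same player. -/
def OwnMove (E : V → V → Prop) (owner : V → Fin n) (u v : V) : Prop :=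
  E u v ∧ ¬ Terminal E v ∧ owner u = owner v

/-- The positions that the owner of `d` can reach from `d` without leaving its own positions. -/
def Territory (E : V → V → Prop) (owner : V → Fin n) : V → V → Prop :=
  Relation.ReflTransGen (OwnMove E owner)

lemma Territory.owner_eq {d v : V} (h : Territory E owner d v) : owner v = owner d := by
  induction h with
  | refl => rfl
  | tail _ h ih => exact h.2.2.symm.trans ih

lemma Territory.not_terminal {d v : V} (hd : ¬ Terminal E d) (h : Territory E owner d v) :
    ¬ Terminal E v := by
  induction h with
  | refl => exact hd
  | tail _ h _ => exact h.2.1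

lemma Territory.tail_of_edge {d v x : V} (h : Territory E owner d v) (hx : E v x)
    (ht : ¬ Terminal E x) (ho : owner x = owner d) : Territory E owner d x :=
  Relation.ReflTransGen.tail h ⟨hx, ht, h.owner_eq.trans ho.symm⟩

lemma Territory.symm (hsym : EdgeSymm E) {d v : V} (h : Territory E owner d v) :
    Territory E owner v d := by
  induction h with
  | refl => exact .refl
  | tail _ h ih =>
    exact Relation.ReflTransGen.head
      ⟨hsym _ _ h.1 h.2.1, fun ht => ht _ h.1, h.2.2.symm⟩ ih

/-- `t` is a terminal adjacent to the territory of `d`. -/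
def TerritoryExit (E : V → V → Prop) (owner : V → Fin n) (d t : V) : Prop :=
  Terminal E t ∧ ∃ u, Territory E owner d u ∧ E u t

/-- `t` is a terminal adjacent to `u`, optimal for the owner of `u` among the exits of its
territory. -/
def BestExit (E : V → V → Prop) (owner : V → Fin n) (L : Fin n → V → ℝ) (u t : V) : Prop :=
  Terminal E t ∧ E u t ∧ ∀ t', TerritoryExit E owner u t' → L (owner u) t ≤ L (owner u) t'

lemma BestExit.le (hsym : EdgeSymm E) {d u t t' : V} (h : BestExit E owner L u t)
    (hu : Territory E owner d u) (ht : TerritoryExit E owner d t') :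
    L (owner d) t ≤ L (owner d) t' := by
  obtain ⟨h1, x, hx, hxt⟩ := ht
  rw [← hu.owner_eq]
  exact h.2.2 t' ⟨h1, x, (hu.symm hsym).trans hx, hxt⟩

lemma exists_bestExit [Fintype V] {d : V} (h : ∃ t, TerritoryExit E owner d t) :
    ∃ u t, Territory E owner d u ∧ BestExit E owner L u t := by
  obtain ⟨t, ht, hmin⟩ := Set.exists_min_image {t | TerritoryExit E owner d t} (L (owner d))
    (Set.toFinite _) h
  obtain ⟨h1, u, hu, hut⟩ := ht
  refine ⟨u, t, hu, h1, hut, ?_⟩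
  rintro t' ⟨h2, x, hx, hxt⟩
  rw [hu.owner_eq]
  exact hmin t' ⟨h2, x, hu.trans hx, hxt⟩

lemma exists_isSituation (E : V → V → Prop) : ∃ h, IsSituation E h := by
  have key : ∀ v, ∃ x, ¬ Terminal E v → E v x := by
    intro v
    by_cases hv : Terminal E v
    · exact ⟨v, fun h => absurd hv h⟩
    · obtain ⟨x, hx⟩ := not_forall_not.1 hv
      exact ⟨x, fun _ => hx⟩
  choose h hh using key
  exact ⟨h, hh⟩

/-- The situation `s` leads the territory of `d` to its position `u`, there moves to `t`, returns
from all neighbours of the territory into it, and agrees with `h` elsewhere. -/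
structure Steers (E : V → V → Prop) (owner : V → Fin n) (d u t : V) (h s : V → V) : Prop where
  isSituation : IsSituation E s
  at_gate : s u = t
  inside : ∀ v, Territory E owner d v → v ≠ u → Territory E owner d (s v)
  cost : ∀ f v, Territory E owner d v → tCost E f s v = tCost E f s t
  back : ∀ v x, ¬ Terminal E v → ¬ Territory E owner d v → Territory E owner d x → E v x →
    Territory E owner d (s v)
  away : ∀ v, ¬ Territory E owner d v → (∀ x, Territory E owner d x → ¬ E v x) → s v = h v

lemma exists_steers (hsym : EdgeSymm E) {d u t : V} {h : V → V} (hh : IsSituation E h)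
    (hd : ¬ Terminal E d) (hu : Territory E owner d u) (hut : E u t) :
    ∃ s, Steers E owner d u t h s := by
  obtain ⟨r, ρ, hr⟩ := exists_route (OwnMove E owner) (· = u)
  have hr' : ∀ v, Territory E owner d v → v ≠ u → OwnMove E owner v (r v) ∧ ρ (r v) < ρ v :=
    fun v hv hvu => hr v ⟨u, (hv.symm hsym).trans hu, rfl⟩ hvu
  let s : V → V := fun v =>
    if v = u then t else if Territory E owner d v then r v
    else if hx : ∃ x, Territory E owner d x ∧ E v x then hx.choose else h v
  have su : s u = t := if_pos rfl
  have sin : ∀ v, Territory E owner d v → v ≠ u → s v = r v := fun v hv hvu => by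
    simp only [s, if_neg hvu, if_pos hv]
  have sback : ∀ v, ¬ Territory E owner d v → (∃ x, Territory E owner d x ∧ E v x) →
      Territory E owner d (s v) ∧ E v (s v) := fun v hv hx => by
    have hvu : v ≠ u := fun e => hv (e ▸ hu)
    simp only [s, if_neg hvu, if_neg hv, dif_pos hx]
    exact hx.choose_spec
  have saway : ∀ v, ¬ Territory E owner d v → (¬ ∃ x, Territory E owner d x ∧ E v x) →
      s v = h v := fun v hv hx => by
    have hvu : v ≠ u := fun e => hv (e ▸ hu)
    simp only [s, if_neg hvu, if_neg hv, dif_neg hx]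
  refine ⟨s, ?_, su, ?_, ?_, ?_, ?_⟩
  · intro v ht
    by_cases hvu : v = u
    · rw [hvu, su]; exact hut
    by_cases hv : Territory E owner d v
    · rw [sin v hv hvu]; exact (hr' v hv hvu).1.1
    by_cases hx : ∃ x, Territory E owner d x ∧ E v x
    · exact (sback v hv hx).2
    · rw [saway v hv hx]; exact hh v ht
  · intro v hv hvu
    rw [sin v hv hvu]
    exact hv.tail (hr' v hv hvu).1
  · intro f v
    induction hk : ρ v using Nat.strong_induction_on generalizing v with
    | _ k ih =>
      intro hv
      rw [tCost_step f s (hv.not_terminal hd)]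
      by_cases hvu : v = u
      · rw [hvu, su]
      · have := hr' v hv hvu
        rw [sin v hv hvu]
        exact ih _ (hk ▸ this.2) _ rfl (hv.tail this.1)
  · exact fun v x _ hv hx hvx => (sback v hv ⟨x, hx, hvx⟩).1
  · exact fun v hv hx => saway v hv fun ⟨x, h1, h2⟩ => hx x h1 h2

/-- Nash equilibrium from `v0`. -/
def IsNash (E : V → V → Prop) (owner : V → Fin n) (L : Fin n → V → ℝ) (v0 : V)
    (s : V → V) : Prop :=
  IsSituation E s ∧ ∀ i s', IsSituation E s' → Deviation E owner i s s' →
    tCost E (L i) s v0 ≤ tCost E (L i) s' v0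

lemma isNash_of_steers_self (hsym : EdgeSymm E) {v0 u t : V} {h s : V → V}
    (hv0 : ¬ Terminal E v0) (hs : Steers E owner v0 u t h s)
    (ht : Terminal E t ∨ Territory E owner v0 t)
    (hneg : tCost E (L (owner v0)) s v0 ≤ 0)
    (hX : ∀ t', TerritoryExit E owner v0 t' →
      tCost E (L (owner v0)) s v0 ≤ L (owner v0) t') :
    IsNash E owner L v0 s := by
  refine ⟨hs.isSituation, fun i s' hs' hd => ?_⟩
  by_cases hi : i = owner v0
  · subst hi
    refine le_tCost_of_deviation hs' hd hneg
      (fun v => Territory E owner v0 v ∨ ∃ x, Territory E owner v0 x ∧ E x v) ?_ ?_ ?_ (Or.inl .refl)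
    · rintro v x (hv | ⟨y, hy, hyv⟩) ho hvx
      · exact Or.inr ⟨v, hv, hvx⟩
      · exact Or.inr ⟨v, hy.tail_of_edge hyv (fun h => h _ hvx) ho, hvx⟩
    · rintro v (hv | ⟨y, hy, hyv⟩) hvt ho
      · exact absurd hv.owner_eq ho
      · exact Or.inl (hs.back v y hvt (fun h => ho h.owner_eq) hy (hsym _ _ hyv hvt))
    · rintro v (hv | ⟨y, hy, hyv⟩) hvt
      · exact absurd hvt (hv.not_terminal hv0)
      · exact hX v ⟨hvt, y, hy, hyv⟩
  · refine (tCost_congr_of_closed _ hd (fun v => Territory E owner v0 v ∨ v = t) ?_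
      (Or.inl .refl)).ge
    intro v hv hvt
    have hv : Territory E owner v0 v := by
      rcases hv with hv | rfl
      · exact hv
      · exact ht.resolve_left hvt
    refine ⟨fun h => hi (h ▸ hv.owner_eq), ?_⟩
    by_cases hvu : v = u
    · exact Or.inr (hvu ▸ hs.at_gate)
    · exact Or.inl (hs.inside v hv hvu)

/-- Opponents of the owner of `v0` have no profitable deviation when `v0` moves into the
territory of its neighbour `d`. -/
lemma opponent_le_of_steers (hsym : EdgeSymm E) {v0 d u t : V} {h s : V → V}
    (hv0 : ¬ Terminal E v0) (hd : ¬ Terminal E d) (hv0d : E v0 d) (ho : owner d ≠ owner v0)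
    (hs : Steers E owner d u t h s)
    (ht : Terminal E t ∨ t = v0)
    (hneg : tCost E (L (owner d)) s v0 ≤ 0)
    (hX : ∀ t', TerritoryExit E owner d t' →
      tCost E (L (owner d)) s v0 ≤ L (owner d) t')
    {i : Fin n} (hi : i ≠ owner v0) {s' : V → V} (hs' : IsSituation E s')
    (hdev : Deviation E owner i s s') : tCost E (L i) s v0 ≤ tCost E (L i) s' v0 := by
  have hv0s : Territory E owner d (s v0) :=
    hs.back v0 d hv0 (fun h => ho h.owner_eq.symm) .refl hv0d
  by_cases hj : i = owner d
  · subst hj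
    refine le_tCost_of_deviation hs' hdev hneg
      (fun v => Territory E owner d v ∨ ∃ x, Territory E owner d x ∧ E x v) ?_ ?_ ?_
      (Or.inr ⟨d, .refl, hsym _ _ hv0d hd⟩)
    · rintro v x (hv | ⟨y, hy, hyv⟩) ho hvx
      · exact Or.inr ⟨v, hv, hvx⟩
      · exact Or.inr ⟨v, hy.tail_of_edge hyv (fun h => h _ hvx) ho, hvx⟩
    · rintro v (hv | ⟨y, hy, hyv⟩) hvt ho
      · exact absurd hv.owner_eq ho
      · exact Or.inl (hs.back v y hvt (fun h => ho h.owner_eq) hy (hsym _ _ hyv hvt))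
    · rintro v (hv | ⟨y, hy, hyv⟩) hvt
      · exact absurd hvt (hv.not_terminal hd)
      · exact hX v ⟨hvt, y, hy, hyv⟩
  · refine (tCost_congr_of_closed _ hdev (fun v => Territory E owner d v ∨ v = t ∨ v = v0) ?_
      (Or.inr (Or.inr rfl))).ge
    intro v hv hvt
    by_cases hvD : Territory E owner d v
    · refine ⟨fun h => hj (h ▸ hvD.owner_eq), ?_⟩
      by_cases hvu : v = u
      · exact Or.inr (Or.inl (hvu ▸ hs.at_gate))
      · exact Or.inl (hs.inside v hvD hvu)
    · have hvv : v = v0 := by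
        rcases hv with hv | rfl | hv
        · exact absurd hv hvD
        · exact ht.resolve_left hvt
        · exact hv
      subst hvv
      exact ⟨hi.symm, Or.inl hv0s⟩

/-- A situation along which every territory with an exit is left at an optimal one. -/
lemma exists_exiting (E : V → V → Prop) (owner : V → Fin n) (L : Fin n → V → ℝ) :
    ∃ (h : V → V) (ρ : V → ℕ), IsSituation E h ∧
      ∀ v, (∃ u t, Territory E owner v u ∧ BestExit E owner L u t) →
        BestExit E owner L v (h v) ∨ (OwnMove E owner v (h v) ∧ ρ (h v) < ρ v) := by
  obtain ⟨h0, hh0⟩ := exists_isSituation E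
  obtain ⟨r, ρ, hr⟩ := exists_route (OwnMove E owner) (fun u => ∃ t, BestExit E owner L u t)
  have key : ∀ v, ∃ x, (¬ Terminal E v → E v x) ∧
      ((∃ u t, Territory E owner v u ∧ BestExit E owner L u t) →
        BestExit E owner L v x ∨ (OwnMove E owner v x ∧ ρ x < ρ v)) := by
    intro v
    by_cases hv : ∃ t, BestExit E owner L v t
    · obtain ⟨t, ht⟩ := hv
      exact ⟨t, fun _ => ht.2.1, fun _ => Or.inl ht⟩
    by_cases hw : ∃ u t, Territory E owner v u ∧ BestExit E owner L u t
    · obtain ⟨u, t, hu, ht⟩ := hw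
      have := hr v ⟨u, hu, t, ht⟩ hv
      exact ⟨r v, fun _ => this.1.1, fun _ => Or.inr this⟩
    · exact ⟨h0 v, hh0 v, fun h => absurd h hw⟩
  choose h hh using key
  exact ⟨h, ρ, fun v => (hh v).1, fun v => (hh v).2⟩

/-- The owner of `v0` has no profitable deviation if all neighbours of `v0` are terminals of cost
at least `c` or belong to a set `K` from which `s` leads to a cost of at least `c`. -/
lemma mover_le_of_closed {s s' : V → V} {v0 : V} {c : ℝ} (hv0 : ¬ Terminal E v0)
    (hs' : IsSituation E s') (hdev : Deviation E owner (owner v0) s s')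
    (K : V → Prop) (ρ : V → ℕ)
    (hK : ∀ v, K v → ¬ Terminal E v ∧ owner v ≠ owner v0 ∧
      ((Terminal E (s v) ∧ c ≤ L (owner v0) (s v)) ∨
        (K (s v) ∧ (ρ (s v) < ρ v ∨ c ≤ tCost E (L (owner v0)) s (s v)))))
    (hN : ∀ x, E v0 x → (Terminal E x ∧ c ≤ L (owner v0) x) ∨ K x) :
    c ≤ tCost E (L (owner v0)) s' v0 := by
  have hle : ∀ v, K v → c ≤ tCost E (L (owner v0)) s v := by
    intro v
    induction hk : ρ v using Nat.strong_induction_on generalizing v with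
    | _ k ih =>
      intro hv
      obtain ⟨ht, -, hc⟩ := hK v hv
      rw [tCost_step _ s ht]
      rcases hc with ⟨hsv, hc⟩ | ⟨hsv, hρ | hc⟩
      · rwa [tCost_of_terminal _ s hsv]
      · exact ih _ (hk ▸ hρ) _ rfl hsv
      · exact hc
  rw [tCost_step _ s' hv0]
  rcases hN _ (hs' v0 hv0) with ⟨ht, hc⟩ | hx
  · rwa [tCost_of_terminal _ s' ht]
  · rw [tCost_congr_of_closed _ hdev (fun v => K v ∨ Terminal E v) ?_ (Or.inl hx)]
    · exact hle _ hx
    · intro v hv ht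
      obtain ⟨-, ho, hc⟩ := hK v (hv.resolve_right ht)
      exact ⟨ho, hc.elim (fun h => Or.inr h.1) fun h => Or.inl h.1⟩

lemma exists_isNash_of_neg_exit [Fintype V] (hsym : EdgeSymm E) {v0 t : V}
    (hv0 : ¬ Terminal E v0) (ht : TerritoryExit E owner v0 t) (hneg : L (owner v0) t < 0) :
    ∃ s, IsNash E owner L v0 s := by
  obtain ⟨u, t', hu, hb⟩ := exists_bestExit (L := L) ⟨t, ht⟩
  obtain ⟨h, hh⟩ := exists_isSituation E
  obtain ⟨s, hs⟩ := exists_steers hsym hh hv0 hu hb.2.1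
  have hc : tCost E (L (owner v0)) s v0 = L (owner v0) t' := by
    rw [hs.cost _ _ .refl, tCost_of_terminal _ s hb.1]
  refine ⟨s, isNash_of_steers_self hsym hv0 hs (Or.inl hb.1) ?_ ?_⟩
  · rw [hc]
    exact (hb.le hsym hu ht).trans hneg.le
  · intro t'' ht''
    rw [hc]
    exact hb.le hsym hu ht''

lemma exists_isNash_of_own_cycle (hsym : EdgeSymm E) {v0 x : V}
    (hv0 : ¬ Terminal E v0) (hx : E v0 x) (hxt : ¬ Terminal E x) (hxo : owner x = owner v0)
    (hX : ∀ t, TerritoryExit E owner v0 t → 0 ≤ L (owner v0) t) :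
    ∃ s, IsNash E owner L v0 s := by
  obtain ⟨h, hh⟩ := exists_isSituation E
  obtain ⟨s, hs⟩ := exists_steers (owner := owner) hsym hh hv0 .refl hx
  have hxD : Territory E owner v0 x := Relation.ReflTransGen.refl.tail ⟨hx, hxt, hxo.symm⟩
  have hc : tCost E (L (owner v0)) s v0 = 0 := by
    refine tCost_eq_zero_of_closed (fun v => Territory E owner v0 v) ?_ .refl
    intro v hv
    refine ⟨hv.not_terminal hv0, ?_⟩
    by_cases hvu : v = v0
    · rw [hvu, hs.at_gate]
      exact hxD
    · exact hs.inside v hv hvu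
  refine ⟨s, isNash_of_steers_self hsym hv0 hs (Or.inr hxD) hc.le ?_⟩
  rwa [hc]

lemma exists_isNash_of_alternating_cycle (hsym : EdgeSymm E) {v0 d : V}
    (hv0 : ¬ Terminal E v0) (hd : ¬ Terminal E d) (hv0d : E v0 d)
    (hown : ∀ x, E v0 x → ¬ Terminal E x → owner x ≠ owner v0)
    (hX0 : ∀ t, E v0 t → Terminal E t → 0 ≤ L (owner v0) t)
    (hX : ∀ t, TerritoryExit E owner d t → 0 ≤ L (owner d) t) :
    ∃ s, IsNash E owner L v0 s := by
  obtain ⟨h0, hh0⟩ := exists_isSituation E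
  obtain ⟨h, hh⟩ := exists_steers (owner := owner) hsym hh0 hv0 .refl hv0d
  obtain ⟨s, hs⟩ := exists_steers (owner := owner) hsym hh.isSituation hd .refl (hsym _ _ hv0d hd)
  have ho := hown d hv0d hd
  have hT : ∀ v, Territory E owner v0 v → v = v0 := by
    intro v hv
    rcases Relation.ReflTransGen.cases_head hv with h | ⟨x, hx, -⟩
    · exact h.symm
    · exact absurd hx.2.2.symm (hown x hx.1 hx.2.1)
  have hv0D : ¬ Territory E owner d v0 := fun h => ho h.owner_eq.symm
  have hs0 : Territory E owner d (s v0) := hs.back v0 d hv0 hv0D .refl hv0d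
  have hsD : ∀ v, Territory E owner d v → Territory E owner d (s v) ∨ s v = v0 := by
    intro v hv
    by_cases hvd : v = d
    · exact Or.inr (hvd ▸ hs.at_gate)
    · exact Or.inl (hs.inside v hv hvd)
  have hc : ∀ f, tCost E f s v0 = 0 := by
    intro f
    refine tCost_eq_zero_of_closed (fun v => Territory E owner d v ∨ v = v0) ?_ (Or.inr rfl)
    rintro v (hv | rfl)
    · exact ⟨hv.not_terminal hd, hsD v hv⟩
    · exact ⟨hv0, Or.inl hs0⟩
  refine ⟨s, hs.isSituation, fun i s' hs' hdev => ?_⟩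
  by_cases hi : i = owner v0
  · subst hi
    rw [hc]
    refine le_tCost_of_deviation hs' hdev le_rfl
      (fun v => v = v0 ∨ Territory E owner d v ∨ E v0 v) ?_ ?_ ?_ (Or.inl rfl)
    · rintro v x (rfl | hv | hv) hvo hvx
      · exact Or.inr (Or.inr hvx)
      · exact absurd (hv.owner_eq.symm.trans hvo) ho
      · exact absurd hvo (hown v hv fun h => h _ hvx)
    · rintro v (rfl | hv | hv) hvt hvo
      · exact absurd rfl hvo
      · exact (hsD v hv).elim (fun h => Or.inr (Or.inl h)) Or.inl
      · by_cases hvD : Territory E owner d v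
        · exact (hsD v hvD).elim (fun h => Or.inr (Or.inl h)) Or.inl
        by_cases hvN : ∃ x, Territory E owner d x ∧ E v x
        · obtain ⟨x, hx, hvx⟩ := hvN
          exact Or.inr (Or.inl (hs.back v x hvt hvD hx hvx))
        · rw [hs.away v hvD fun x hx hvx => hvN ⟨x, hx, hvx⟩]
          exact Or.inl (hT _ (hh.back v v0 hvt (fun h => hvo h.owner_eq) .refl (hsym _ _ hv hvt)))
    · rintro v (rfl | hv | hv) hvt
      · exact absurd hvt hv0
      · exact absurd hvt (hv.not_terminal hd)
      · exact hX0 v hv hvt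
  · refine opponent_le_of_steers hsym hv0 hd hv0d ho hs (Or.inr rfl) (hc _).le ?_ hi hs' hdev
    rwa [hc]

lemma exists_isNash_of_neighbours_exit [Fintype V] (hsym : EdgeSymm E) {v0 : V}
    (hv0 : ¬ Terminal E v0) (hown : ∀ x, E v0 x → ¬ Terminal E x → owner x ≠ owner v0)
    (hX : ∀ d, E v0 d → ¬ Terminal E d → ∃ t, TerritoryExit E owner d t ∧ L (owner d) t < 0) :
    ∃ s, IsNash E owner L v0 s := by
  obtain ⟨h, ρ, hh, hexit⟩ := exists_exiting E owner L
  let K : V → Prop := fun v => ∃ d, E v0 d ∧ ¬ Terminal E d ∧ Territory E owner d v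
  have hK : ∀ v, K v → ¬ Terminal E v ∧ owner v ≠ owner v0 := by
    rintro v ⟨d, hd, hdt, hv⟩
    exact ⟨hv.not_terminal hdt, hv.owner_eq ▸ hown d hd hdt⟩
  have hKexit : ∀ v, K v → BestExit E owner L v (h v) ∨ (K (h v) ∧ ρ (h v) < ρ v) := by
    rintro v ⟨d, hd, hdt, hv⟩
    obtain ⟨t, ht, -⟩ := hX d hd hdt
    obtain ⟨u, t', hu, hb⟩ := exists_bestExit (L := L) ⟨t, ht⟩
    refine (hexit v ⟨u, t', (hv.symm hsym).trans hu, hb⟩).imp_right ?_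
    exact fun hm => ⟨⟨d, hd, hdt, hv.tail hm.1⟩, hm.2⟩
  let Z : Set V := {t | Terminal E t ∧ (E v0 t ∨ ∃ u, K u ∧ BestExit E owner L u t)}
  have hZ : Z.Nonempty := by
    obtain ⟨x, hx⟩ := not_forall_not.1 hv0
    by_cases hxt : Terminal E x
    · exact ⟨x, hxt, Or.inl hx⟩
    · obtain ⟨t, ht, -⟩ := hX x hx hxt
      obtain ⟨u, t', hu, hb⟩ := exists_bestExit (L := L) ⟨t, ht⟩
      exact ⟨t', hb.1, Or.inr ⟨u, ⟨x, hx, hxt, hu⟩, hb⟩⟩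
  obtain ⟨t, ⟨htt, ht⟩, hmin⟩ := Set.exists_min_image Z (L (owner v0)) (Set.toFinite _) hZ
  have hN : ∀ x, E v0 x → (Terminal E x ∧ L (owner v0) t ≤ L (owner v0) x) ∨ K x := by
    intro x hx
    by_cases hxt : Terminal E x
    · exact Or.inl ⟨hxt, hmin x ⟨hxt, Or.inl hx⟩⟩
    · exact Or.inr ⟨x, hx, hxt, .refl⟩
  rcases ht with ht | ⟨u, ⟨d, hv0d, hd, hu⟩, hb⟩
  · have hs0 : Function.update h v0 t v0 = t := Function.update_self ..
    have hs : ∀ v, v ≠ v0 → Function.update h v0 t v = h v :=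
      fun v hv => Function.update_of_ne hv ..
    have hc : ∀ f, tCost E f (Function.update h v0 t) v0 = f t := by
      intro f
      rw [tCost_step f _ hv0, hs0, tCost_of_terminal f _ htt]
    refine ⟨Function.update h v0 t, ?_, fun i s' hs' hdev => ?_⟩
    · intro v hv
      by_cases hvv : v = v0
      · rw [hvv, hs0]
        exact ht
      · rw [hs v hvv]
        exact hh v hv
    by_cases hi : i = owner v0
    · subst hi
      rw [hc]
      refine mover_le_of_closed hv0 hs' hdev K ρ (fun v hv => ?_) hN
      obtain ⟨hvt, hvo⟩ := hK v hv
      rw [hs v fun e => hvo (e ▸ rfl)]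
      refine ⟨hvt, hvo, (hKexit v hv).imp (fun hb => ?_) fun hm => ⟨hm.1, Or.inl hm.2⟩⟩
      exact ⟨hb.1, hmin _ ⟨hb.1, Or.inr ⟨v, hv, hb⟩⟩⟩
    · refine (tCost_congr_of_closed _ hdev (fun v => v = v0 ∨ v = t) ?_ (Or.inl rfl)).ge
      rintro v (rfl | rfl) hvt
      · exact ⟨fun h => hi h.symm, Or.inr hs0⟩
      · exact absurd htt hvt
  · obtain ⟨s, hs⟩ := exists_steers hsym hh hd hu hb.2.1
    have ho := hown d hv0d hd
    have hKD : ∀ v, Territory E owner d v → K v := fun v hv => ⟨d, hv0d, hd, hv⟩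
    have hcD : ∀ f v, Territory E owner d v → tCost E f s v = f t := by
      intro f v hv
      rw [hs.cost f v hv, tCost_of_terminal f s htt]
    have hc : ∀ f, tCost E f s v0 = f t := by
      intro f
      rw [tCost_step f s hv0]
      exact hcD f _ (hs.back v0 d hv0 (fun h => ho h.owner_eq.symm) .refl hv0d)
    refine ⟨s, hs.isSituation, fun i s' hs' hdev => ?_⟩
    by_cases hi : i = owner v0
    · subst hi
      rw [hc]
      refine mover_le_of_closed hv0 hs' hdev K ρ (fun v hv => ?_) hN
      obtain ⟨hvt, hvo⟩ := hK v hv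
      refine ⟨hvt, hvo, ?_⟩
      by_cases hvD : Territory E owner d v
      · by_cases hvu : v = u
        · rw [hvu, hs.at_gate]
          exact Or.inl ⟨htt, le_rfl⟩
        · have hsv := hs.inside v hvD hvu
          exact Or.inr ⟨hKD _ hsv, Or.inr (hcD _ _ hsv).ge⟩
      by_cases hvN : ∃ x, Territory E owner d x ∧ E v x
      · obtain ⟨x, hx, hvx⟩ := hvN
        have hsv := hs.back v x hvt hvD hx hvx
        exact Or.inr ⟨hKD _ hsv, Or.inr (hcD _ _ hsv).ge⟩
      · rw [hs.away v hvD fun x hx hvx => hvN ⟨x, hx, hvx⟩]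
        refine (hKexit v hv).imp (fun hb => ?_) fun hm => ⟨hm.1, Or.inl hm.2⟩
        exact ⟨hb.1, hmin _ ⟨hb.1, Or.inr ⟨v, hv, hb⟩⟩⟩
    · obtain ⟨t', ht', hneg⟩ := hX d hv0d hd
      refine opponent_le_of_steers hsym hv0 hd hv0d ho hs (Or.inl htt) ?_ ?_ hi hs' hdev
      · rw [hc]
        exact (hb.le hsym hu ht').trans hneg.le
      · intro t'' ht''
        rw [hc]
        exact hb.le hsym hu ht''

end Helpers

/-- Every edge-symmetric `n`-person terminal game
`Γ = (G, v₀, 𝓛)` has a Nash equilibrium in pure stationary strategies. -/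
theorem edgeSymmetric_terminalGame_has_NE
    {V : Type} [Fintype V] {n : ℕ}
    (E : V → V → Prop) (owner : V → Fin n) (L : Fin n → V → ℝ) (v0 : V)
    (hT : ∃ v, Terminal E v)        -- the set of terminals is nonempty
    (hv0 : ¬ Terminal E v0)         -- the initial position is not terminal
    (hsym : EdgeSymm E)             -- the game is edge-symmetric
    :
    ∃ s, IsSituation E s ∧
      ∀ i s', IsSituation E s' → Deviation E owner i s s' →
        tCost E (L i) s v0 ≤ tCost E (L i) s' v0 := by
  suffices h : ∃ s, IsNash E owner L v0 s from h
  by_cases h1 : ∃ t, TerritoryExit E owner v0 t ∧ L (owner v0) t < 0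
  · obtain ⟨t, ht, hneg⟩ := h1
    exact exists_isNash_of_neg_exit hsym hv0 ht hneg
  have hX0 : ∀ t, TerritoryExit E owner v0 t → 0 ≤ L (owner v0) t :=
    fun t ht => not_lt.1 fun hneg => h1 ⟨t, ht, hneg⟩
  by_cases h2 : ∃ x, E v0 x ∧ ¬ Terminal E x ∧ owner x = owner v0
  · obtain ⟨x, hx, hxt, hxo⟩ := h2
    exact exists_isNash_of_own_cycle hsym hv0 hx hxt hxo hX0
  have hown : ∀ x, E v0 x → ¬ Terminal E x → owner x ≠ owner v0 :=
    fun x hx hxt hxo => h2 ⟨x, hx, hxt, hxo⟩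
  by_cases h3 : ∀ d, E v0 d → ¬ Terminal E d →
      ∃ t, TerritoryExit E owner d t ∧ L (owner d) t < 0
  · exact exists_isNash_of_neighbours_exit hsym hv0 hown h3
  push Not at h3
  obtain ⟨d, hv0d, hd, hX⟩ := h3
  exact exists_isNash_of_alternating_cycle hsym hv0 hd hv0d hown
    (fun t ht htt => hX0 t ⟨htt, v0, .refl, ht⟩) hX
end

section
/- Every edge-symmetric terminal game satisfying condition (CIW) has a Nash equilibrium in pure stationary strategies; moreover, it has a terminal Nash equilibrium (one whose play reaches a terminal) whenever V_T is reachable from the initial position v₀. -/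
open scoped Classical

section Helpers

variable {V : Type}

/-- If `t` is `Q`-reachable from `x ≠ t`, some successor map follows `Q` and decreases a
potential at every such `x`. -/
theorem exists_successor_decreasing (Q : V → V → Prop) (t : V) :
    ∃ (f : V → V) (d : V → ℕ), ∀ x, Relation.ReflTransGen Q x t → x ≠ t →
      Q x (f x) ∧ d (f x) < d x := by
  let reachIn : ℕ → V → Prop := fun n =>
    Nat.rec (fun x => x = t) (fun _ p x => ∃ y, Q x y ∧ p y) n
  have hex : ∀ x, Relation.ReflTransGen Q x t → ∃ n, reachIn n x := by
    intro x hx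
    induction hx using Relation.ReflTransGen.head_induction_on with
    | refl => exact ⟨0, rfl⟩
    | head hac _ ih =>
      obtain ⟨n, hn⟩ := ih
      exact ⟨n + 1, _, hac, hn⟩
  let d : V → ℕ := fun x => sInf {n | reachIn n x}
  have key : ∀ x, ∃ y, Relation.ReflTransGen Q x t → x ≠ t → Q x y ∧ d y < d x := by
    intro x
    by_cases h : Relation.ReflTransGen Q x t ∧ x ≠ t
    · have hd : reachIn (d x) x := Nat.sInf_mem (s := {n | reachIn n x}) (hex x h.1)
      cases hn : d x with
      | zero =>
        rw [hn] at hd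
        exact absurd hd h.2
      | succ m =>
        rw [hn] at hd
        obtain ⟨y, hxy, hy⟩ := hd
        exact ⟨y, fun _ _ => ⟨hxy, Nat.lt_succ_of_le (Nat.sInf_le hy)⟩⟩
    · exact ⟨x, fun h1 h2 => absurd ⟨h1, h2⟩ h⟩
  choose f hf using key
  exact ⟨f, d, hf⟩

theorem terminal_playEnd {E : V → V → Prop} {s : V → V} {v : V} (h : Reaches E s v) :
    Terminal E (playEnd E s v) :=
  Nat.sInf_mem (s := {k | Terminal E (s^[k] v)}) h

/-- A property preserved by moves from non-terminal positions holds at the end of the play. -/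
theorem playEnd_of_invariant {E : V → V → Prop} {s : V → V} {v : V} (p : V → Prop)
    (hv : p v) (hstep : ∀ x, p x → ¬ Terminal E x → p (s x)) :
    p (playEnd E s v) := by
  have h : ∀ k, k ≤ stopTime E s v → p (s^[k] v) := by
    intro k
    induction k with
    | zero => exact fun _ => hv
    | succ k ih =>
      intro hk
      rw [Function.iterate_succ_apply']
      exact hstep _ (ih (by omega)) (Nat.notMem_of_lt_sInf (s := {k | Terminal E (s^[k] v)}) hk)
  exact h _ le_rfl

/-- If no terminal is reachable, then no play terminates. -/
theorem not_reaches_of_forall_not_reachable {E : V → V → Prop} {s : V → V} {v : V}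
    (hs : IsSituation E s) (h : ∀ t, Terminal E t → ¬ Relation.ReflTransGen E v t) :
    ¬ Reaches E s v := by
  intro hr
  exact h _ (terminal_playEnd hr) (playEnd_of_invariant (Relation.ReflTransGen E v) .refl
    fun x hx hxT => hx.tail (hs x hxT))

/-- Two adjacent non-terminal positions with the same owner. -/
def SameOwnerAdj {n : ℕ} (E : V → V → Prop) (owner : V → Fin n) (x y : V) : Prop :=
  E x y ∧ ¬ Terminal E x ∧ ¬ Terminal E y ∧ owner x = owner y

theorem SameOwnerAdj.symm {n : ℕ} {E : V → V → Prop} {owner : V → Fin n}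
    (hsym : EdgeSymm E) {x y : V} (h : SameOwnerAdj E owner x y) : SameOwnerAdj E owner y x :=
  ⟨hsym _ _ h.1 h.2.2.1, h.2.2.1, h.2.1, h.2.2.2.symm⟩

/-- A set of positions closed under moves between positions of the same owner, all of whose
moves into terminals belong to one player, for whom `t` is the best of these terminals,
carries a terminal Nash equilibrium. -/
theorem exists_terminal_NE_of_closed_set {n : ℕ}
    {E : V → V → Prop} {owner : V → Fin n} {L : Fin n → V → ℝ} {v0 : V}
    (hsym : EdgeSymm E) (hCIW : ∀ i w, Terminal E w → L i w < 0)
    (S : Set V) (t : V) (hv : v0 ∈ S) (hS : ∀ x ∈ S, ¬ Terminal E x)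
    (hcl : ∀ x ∈ S, ∀ y, SameOwnerAdj E owner x y → y ∈ S)
    (ht : Terminal E t)
    (hbest : ∀ x ∈ S, ∀ w, E x w → Terminal E w → L (owner x) t ≤ L (owner x) w)
    (hreach : ∀ x ∈ S, Relation.ReflTransGen (fun x y => E x y ∧ (y ∈ S ∨ y = t)) x t) :
    ∃ s, (IsSituation E s ∧
      ∀ i s', IsSituation E s' → Deviation E owner i s s' →
        tCost E (L i) s v0 ≤ tCost E (L i) s' v0) ∧ Reaches E s v0 := by
  obtain ⟨f, d, hf⟩ := exists_successor_decreasing (fun x y => E x y ∧ (y ∈ S ∨ y = t)) t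
  have hf' : ∀ x ∈ S, (E x (f x) ∧ (f x ∈ S ∨ f x = t)) ∧ d (f x) < d x := fun x hx =>
    hf x (hreach x hx) fun h => hS x hx (h ▸ ht)
  have hs : ∀ x, ∃ y, (x ∈ S → y = f x) ∧ (x ∉ S → (∃ z ∈ S, E x z) → y ∈ S) ∧
      (¬ Terminal E x → E x y) := by
    intro x
    by_cases hx : x ∈ S
    · exact ⟨f x, fun _ => rfl, fun h => absurd hx h, fun _ => (hf' x hx).1.1⟩
    · by_cases hz : ∃ z ∈ S, E x z
      · obtain ⟨z, hzS, hxz⟩ := hz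
        exact ⟨z, fun h => absurd h hx, fun _ _ => hzS, fun _ => hxz⟩
      · by_cases hT : Terminal E x
        · exact ⟨x, fun h => absurd h hx, fun _ h => absurd h hz, fun h => absurd hT h⟩
        · obtain ⟨y, hy⟩ := not_forall_not.mp hT
          exact ⟨y, fun h => absurd h hx, fun _ h => absurd h hz, fun _ => hy⟩
  choose s hsS hsN hsE using hs
  have hstep : ∀ x ∈ S, s x ∈ S ∨ s x = t := fun x hx => by
    rw [hsS x hx]; exact (hf' x hx).1.2
  have hr : Reaches E s v0 := by
    have : ∀ m, ∀ x ∈ S, d x ≤ m → Reaches E s x := by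
      intro m
      induction m with
      | zero => intro x hx h; have := (hf' x hx).2; omega
      | succ m ih =>
        intro x hx h
        have hd := (hf' x hx).2
        rcases hstep x hx with h1 | h1
        · obtain ⟨k, hk⟩ := ih (s x) h1 (by rw [hsS x hx]; omega)
          exact ⟨k + 1, hk⟩
        · exact ⟨1, by simpa [h1] using ht⟩
    exact this _ v0 hv le_rfl
  have hend : playEnd E s v0 = t := by
    have h := playEnd_of_invariant (E := E) (s := s) (fun x => x ∈ S ∨ x = t) (Or.inl hv) (by
      rintro x (hx | rfl) hxT
      · exact hstep x hx
      · exact absurd ht hxT)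
    exact h.resolve_left fun h => hS _ h (terminal_playEnd hr)
  refine ⟨s, ⟨hsE, fun i s' hs' hdev => ?_⟩, hr⟩
  unfold tCost
  rw [if_pos hr, hend]
  split_ifs with hr'
  · have hT := terminal_playEnd hr'
    have h := playEnd_of_invariant (E := E) (s := s') (v := v0)
      (fun x => x ∈ S ∨ (x ∉ S ∧ ¬ Terminal E x ∧ owner x ≠ i ∧ ∃ y ∈ S, E y x) ∨
        (Terminal E x ∧ L i t ≤ L i x)) (Or.inl hv) (by
      rintro x (hx | ⟨hxS, hxT, hxi, y, hy, hyx⟩ | hx) hxT'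
      · by_cases hi : owner x = i
        · have hE := hs' x hxT'
          by_cases hT' : Terminal E (s' x)
          · exact .inr (.inr ⟨hT', hi ▸ hbest x hx _ hE hT'⟩)
          · by_cases hi' : owner (s' x) = i
            · exact .inl (hcl x hx _ ⟨hE, hxT', hT', hi.trans hi'.symm⟩)
            · by_cases hmem : s' x ∈ S
              · exact .inl hmem
              · exact .inr (.inl ⟨hmem, hT', hi', x, hx, hE⟩)
        · rw [hdev x (.inl hi)]
          rcases hstep x hx with h | h
          · exact .inl h
          · exact .inr (.inr (by rw [h]; exact ⟨ht, le_rfl⟩))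
      · left
        rw [hdev x (.inl hxi)]
        exact hsN x hxS ⟨y, hy, hsym _ _ hyx hxT⟩
      · exact absurd hx.1 hxT')
    rcases h with h | h | h
    · exact absurd hT (hS _ h)
    · exact absurd hT h.2.1
    · exact h.2
  · exact (hCIW i t ht).le

/-- A position from which its owner can reach a terminal using only their own positions. -/
def OwnerExits {n : ℕ} (E : V → V → Prop) (owner : V → Fin n) (x : V) : Prop :=
  ¬ Terminal E x ∧ ∃ y, Relation.ReflTransGen (SameOwnerAdj E owner) x y ∧
    ∃ w, Terminal E w ∧ E y w

theorem exists_path_to_ownerExits {n : ℕ} {E : V → V → Prop} {owner : V → Fin n}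
    {t : V} (ht : Terminal E t) {x : V} (h : Relation.ReflTransGen E x t)
    (hx : ¬ Terminal E x) :
    OwnerExits E owner x ∨ ∃ a b, Relation.ReflTransGen
      (fun x y => E x y ∧ ¬ Terminal E y ∧ ¬ OwnerExits E owner y) x a ∧
        E a b ∧ OwnerExits E owner b := by
  induction h using Relation.ReflTransGen.head_induction_on with
  | refl => exact absurd ht hx
  | @head x c hxc _ ih =>
    by_cases hc : Terminal E c
    · exact .inl ⟨hx, x, .refl, c, hc, hxc⟩
    · right
      by_cases hB : OwnerExits E owner c
      · exact ⟨x, c, .refl, hxc, hB⟩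
      · obtain ⟨a, b, hca, hab⟩ := (ih hc).resolve_left hB
        exact ⟨a, b, .head ⟨hxc, hc, hB⟩ hca, hab⟩

theorem sameOwner_reachable {n : ℕ} {E : V → V → Prop} {owner : V → Fin n} {b x : V}
    (hb : ¬ Terminal E b) (h : Relation.ReflTransGen (SameOwnerAdj E owner) b x) :
    ¬ Terminal E x ∧ owner x = owner b := by
  induction h with
  | refl => exact ⟨hb, rfl⟩
  | tail _ h ih => exact ⟨h.2.2.1, h.2.2.2.symm.trans ih.2⟩

/-- An edge-symmetric game with all terminals better than infinite play has a terminal Nash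
equilibrium as soon as some terminal is reachable. -/
theorem exists_terminal_NE [Fintype V] {n : ℕ}
    {E : V → V → Prop} {owner : V → Fin n} {L : Fin n → V → ℝ} {v0 : V}
    (hv0 : ¬ Terminal E v0) (hsym : EdgeSymm E) (hCIW : ∀ i w, Terminal E w → L i w < 0)
    (hreach : ∃ t, Terminal E t ∧ Relation.ReflTransGen E v0 t) :
    ∃ s, (IsSituation E s ∧
      ∀ i s', IsSituation E s' → Deviation E owner i s s' →
        tCost E (L i) s v0 ≤ tCost E (L i) s' v0) ∧ Reaches E s v0 := by
  have hsymm : Std.Symm (SameOwnerAdj E owner) := ⟨fun _ _ h => h.symm hsym⟩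
  -- `S₀` is connected, without moves to terminals, and leads to `b`.
  obtain ⟨S₀, b, hb, hv, hS₀, hcl, hconn⟩ : ∃ (S₀ : Set V) (b : V), OwnerExits E owner b ∧
      (v0 ∈ S₀ ∨ v0 = b) ∧ (∀ x ∈ S₀, ¬ Terminal E x ∧ ¬ OwnerExits E owner x) ∧
      (∀ x ∈ S₀, ∀ y, E x y → ¬ Terminal E y → ¬ OwnerExits E owner y → y ∈ S₀) ∧
      (∀ x ∈ S₀, Relation.ReflTransGen (fun x y => E x y ∧ (y ∈ S₀ ∨ y = b)) x b) := by
    by_cases hB : OwnerExits E owner v0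
    · exact ⟨∅, v0, hB, .inr rfl, by simp, by simp, by simp⟩
    · obtain ⟨t, ht, hvt⟩ := hreach
      obtain ⟨a, b, hva, hab, hb⟩ :=
        (exists_path_to_ownerExits (owner := owner) ht hvt hv0).resolve_left hB
      set R : V → V → Prop := fun x y => E x y ∧ ¬ Terminal E y ∧ ¬ OwnerExits E owner y
      have hS : ∀ x, Relation.ReflTransGen R v0 x → ¬ Terminal E x ∧ ¬ OwnerExits E owner x := by
        intro x hx
        cases hx with
        | refl => exact ⟨hv0, hB⟩
        | tail _ h => exact h.2
      refine ⟨{x | Relation.ReflTransGen R v0 x}, b, hb, .inl .refl, hS,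
        fun x hx y hxy hy hyB => hx.tail ⟨hxy, hy, hyB⟩, fun x hx => ?_⟩
      have hback : Relation.ReflTransGen
          (fun x y => E x y ∧ (Relation.ReflTransGen R v0 y ∨ y = b)) x v0 := by
        have hx' : Relation.ReflTransGen R v0 x := hx
        induction hx' with
        | refl => exact .refl
        | tail h1 h2 ih => exact .head ⟨hsym _ _ h2.1 h2.2.1, .inl h1⟩ (ih h1)
      have hforth : Relation.ReflTransGen
          (fun x y => E x y ∧ (Relation.ReflTransGen R v0 y ∨ y = b)) v0 a := by
        clear hab
        induction hva with
        | refl => exact .refl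
        | tail h1 h2 ih => exact ih.tail ⟨h2.1, .inl (h1.tail h2)⟩
      exact (hback.trans hforth).tail ⟨hab, .inr rfl⟩
  -- `C` is the same-owner component of `b`, and `t` its owner's best exit.
  set C : Set V := {x | Relation.ReflTransGen (SameOwnerAdj E owner) b x} with hC
  have hCown : ∀ x ∈ C, ¬ Terminal E x ∧ owner x = owner b := fun x hx =>
    sameOwner_reachable hb.1 hx
  obtain ⟨t, ⟨ht, y, hy, hyt⟩, hmin⟩ := Set.exists_min_image
    {w | Terminal E w ∧ ∃ y ∈ C, E y w} (L (owner b)) (Set.toFinite _) (by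
      obtain ⟨y, hby, w, hw, hyw⟩ := hb.2
      exact ⟨w, hw, y, hby, hyw⟩)
  have hexit : ∀ {x z}, SameOwnerAdj E owner x z → OwnerExits E owner z →
      OwnerExits E owner x := fun h hz =>
    ⟨h.2.1, hz.2.choose, .head h hz.2.choose_spec.1, hz.2.choose_spec.2⟩
  have hCreach : ∀ x ∈ C, Relation.ReflTransGen
      (fun x y => E x y ∧ (y ∈ S₀ ∪ C ∨ y = t)) x t := by
    intro x hx
    have hxy : Relation.ReflTransGen (SameOwnerAdj E owner) x y := 
      (Std.Symm.symm (r := Relation.ReflTransGen (SameOwnerAdj E owner)) _ _ hx).trans hy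
    clear hmin
    induction hxy using Relation.ReflTransGen.head_induction_on with
    | refl => exact .single ⟨hyt, .inr rfl⟩
    | head h _ ih =>
      have hc := Relation.ReflTransGen.tail hx h
      exact .head ⟨h.1, .inl (.inr hc)⟩ (ih hc)
  refine exists_terminal_NE_of_closed_set hsym hCIW (S₀ ∪ C) t ?_ ?_ ?_ ht ?_ ?_
  · rcases hv with h | rfl
    · exact .inl h
    · exact .inr .refl
  · rintro x (hx | hx)
    · exact (hS₀ x hx).1
    · exact (hCown x hx).1
  · rintro x (hx | hx) z hxz
    · exact .inl (hcl x hx z hxz.1 hxz.2.2.1 fun hz => (hS₀ x hx).2 (hexit hxz hz))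
    · exact .inr (Relation.ReflTransGen.tail hx hxz)
  · rintro x (hx | hx) w hxw hw
    · exact absurd ⟨(hS₀ x hx).1, x, .refl, w, hw, hxw⟩ (hS₀ x hx).2
    · rw [(hCown x hx).2]
      exact hmin w ⟨hw, x, hx, hxw⟩
  · rintro x (hx | hx)
    · refine Relation.ReflTransGen.trans
        (Relation.ReflTransGen.mono (fun u z h => ⟨h.1, ?_⟩) x b (hconn x hx)) (hCreach b .refl)
      rcases h.2 with h | rfl
      · exact .inl (.inl h)
      · exact .inl (.inr .refl)
    · exact hCreach x hx

end Helpers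

/-- Every edge-symmetric terminal game satisfying (CIW) has
a Nash equilibrium in pure stationary strategies; moreover it has a terminal
Nash equilibrium whenever `V_T` is reachable from the initial position `v₀`. -/
theorem edgeSymmetric_CIW_terminalGame_has_NE
    {V : Type} [Fintype V] {n : ℕ}
    (E : V → V → Prop) (owner : V → Fin n) (L : Fin n → V → ℝ) (v0 : V)
    (hT : ∃ v, Terminal E v)        -- the set of terminals is nonempty
    (hv0 : ¬ Terminal E v0)         -- the initial position is not terminal
    (hsym : EdgeSymm E)             -- the game is edge-symmetric
    (hCIW : ∀ i w, Terminal E w → L i w < 0)  -- (CIW)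
    :
    (∃ s, IsSituation E s ∧
      ∀ i s', IsSituation E s' → Deviation E owner i s s' →
        tCost E (L i) s v0 ≤ tCost E (L i) s' v0) ∧
    ((∃ t, Terminal E t ∧ Relation.ReflTransGen E v0 t) →
      ∃ s, (IsSituation E s ∧
        ∀ i s', IsSituation E s' → Deviation E owner i s s' →
          tCost E (L i) s v0 ≤ tCost E (L i) s' v0) ∧
        Reaches E s v0) := by
  refine ⟨?_, exists_terminal_NE hv0 hsym hCIW⟩
  by_cases hreach : ∃ t, Terminal E t ∧ Relation.ReflTransGen E v0 t
  · obtain ⟨s, hs, -⟩ := exists_terminal_NE (owner := owner) hv0 hsym hCIW hreach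
    exact ⟨s, hs⟩
  · have hnone : ∀ t, Terminal E t → ¬ Relation.ReflTransGen E v0 t := fun t ht h =>
      hreach ⟨t, ht, h⟩
    have hs : ∀ x, ∃ y, ¬ Terminal E x → E x y := fun x => by
      by_cases hx : Terminal E x
      · exact ⟨x, fun h => absurd hx h⟩
      · obtain ⟨y, hy⟩ := not_forall_not.mp hx
        exact ⟨y, fun _ => hy⟩
    choose s hs using hs
    refine ⟨s, hs, fun i s' hs' _ => ?_⟩
    unfold tCost
    rw [if_neg (not_reaches_of_forall_not_reachable hs hnone),
      if_neg (not_reaches_of_forall_not_reachable hs' hnone)]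
end
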